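/- For every integer n ≥ 5, the group G = T2(n) of order 3^n satisfies S(G) = 12 + 2·3^{n−2}, and for n = 4 the group G = T2(4) satisfies S(G) = 38, where S(G) = Σ_C log₃ |C_G(g_C)/Frat(C_G(g_C))|, the sum running over the conjugacy classes C of G with g_C ∈ C an arbitrary representative (the summand does not depend on the choice of representative). -/

import Mathlib

/-- The commutator `[x,y] = x⁻¹y⁻¹xy`. -/
def gpComm {G : Type*} [Group G] (x y : G) : G := x⁻¹ * y⁻¹ * x * y

namespace MaxClass3

/-- The free generators `a`, `b`, `c`, `d`. -/
abbrev a : FreeGroup (Fin 4) := FreeGroup.of 0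
abbrev b : FreeGroup (Fin 4) := FreeGroup.of 1
abbrev c : FreeGroup (Fin 4) := FreeGroup.of 2
abbrev d : FreeGroup (Fin 4) := FreeGroup.of 3

/-- The word representing the central element `z`. -/
def zWord (n : ℕ) : FreeGroup (Fin 4) :=
  if Even n then d ^ ((-3 : ℤ) ^ ((n - 4) / 2)) else c ^ ((-3 : ℤ) ^ ((n - 3) / 2))

/-- Relators of the group `𝒦(n)`: `c = [b,a]`, `d = [c,a]`, `[d,a] = c⁻³d⁻³`,
`[d,b] = [d,c] = 1`, together with the exponent relations depending on the parity of `n`. -/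
def Krels (n : ℕ) : Set (FreeGroup (Fin 4)) :=
  {c⁻¹ * gpComm b a, d⁻¹ * gpComm c a, gpComm d a * d ^ 3 * c ^ 3, gpComm d b, gpComm d c} ∪
    (if Even n then {c ^ 3 ^ ((n - 2) / 2), d ^ 3 ^ ((n - 2) / 2)}
     else {c ^ 3 ^ ((n - 1) / 2), d ^ 3 ^ ((n - 3) / 2)})

/-- Relators of `T2(n)`: those of `𝒦(n)` together with `a³ = 1`, `b³ = c⁻³d⁻¹z`, `[c,b] = 1`. -/
def T2rels (n : ℕ) : Set (FreeGroup (Fin 4)) :=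
  Krels n ∪ {a ^ 3, b ^ 3 * (zWord n)⁻¹ * d * c ^ 3, gpComm c b}

/-- The group `T2(n)`. -/
abbrev T2 (n : ℕ) : Type := PresentedGroup (T2rels n)

end MaxClass3

/-- `S(G) = Σ_C log₃ |C_G(g_C)/Frat(C_G(g_C))|`, the sum over the conjugacy classes `C` of `G`
of the `3`-logarithm of the order of the Frattini quotient of the centralizer of a
representative of `C`. -/
noncomputable def SInvariant (G : Type*) [Group G] : ℕ :=
  ∑ᶠ C : ConjClasses G,
    Nat.log 3 (Nat.card
      (↥(Subgroup.centralizer {(ConjClasses.exists_rep C).choose}) ⧸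
        frattini ↥(Subgroup.centralizer {(ConjClasses.exists_rep C).choose})))

/-- The Frattini subgroup lies in the kernel of every character of order `3`. -/
theorem frattini_le_ker_zmod_three {H : Type*} [Group H] (f : H →* Multiplicative (ZMod 3)) :
    frattini H ≤ f.ker := by
  have hcard : Nat.card (Multiplicative (ZMod 3)) = 3 := by simp
  have : IsSimpleGroup (Multiplicative (ZMod 3)) := isSimpleGroup_of_prime_card (p := 3) hcard
  rcases (inferInstance : f.range.Normal).eq_bot_or_eq_top with h | h
  · intro x _
    have : f x ∈ f.range := ⟨x, rfl⟩
    rw [h] at this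
    exact this
  · have hs : Function.Surjective f := MonoidHom.range_eq_top.mp h
    refine (frattini_le_comap_frattini_of_surjective hs).trans ?_
    rw [MonoidHom.ker]
    exact Subgroup.comap_mono
      (frattini_le_coatom (G := Multiplicative (ZMod 3)) (K := ⊥) isCoatom_bot)

/-- In a finite `3`-group, a maximal subgroup is normal and its quotient has order `3`. -/
theorem IsCoatom.normal_index_three {H : Type*} [Group H] [Finite H] (hH : IsPGroup 3 H)
    {M : Subgroup H} (hM : IsCoatom M) : M.Normal ∧ M.index = 3 := by
  have : Fact (Nat.Prime 3) := ⟨Nat.prime_three⟩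
  have : Group.IsNilpotent H := hH.isNilpotent
  have hn : M.Normal := Subgroup.NormalizerCondition.normal_of_coatom (G := H) M
    (Group.normalizerCondition_of_isNilpotent (G := H)) hM
  refine ⟨hn, ?_⟩
  obtain ⟨k, hk⟩ := hH.index M
  have hk0 : k ≠ 0 := by
    rintro rfl
    exact hM.1 (Subgroup.index_eq_one.mp (by simpa using hk))
  have hd : 3 ∣ Nat.card (H ⧸ M) := by
    rw [← Subgroup.index_eq_card, hk]
    exact dvd_pow_self 3 hk0
  obtain ⟨x, hx⟩ := exists_prime_orderOf_dvd_card' (G := H ⧸ M) 3 hd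
  have hle : M ≤ (Subgroup.zpowers x).comap (QuotientGroup.mk' M) := by
    intro m hm
    rw [Subgroup.mem_comap, QuotientGroup.mk'_apply, (QuotientGroup.eq_one_iff m).mpr hm]
    exact one_mem _
  have htop : (Subgroup.zpowers x).comap (QuotientGroup.mk' M) = ⊤ := by
    refine hM.2 _ (lt_of_le_of_ne hle fun h => ?_)
    obtain ⟨y, rfl⟩ := QuotientGroup.mk'_surjective M x
    have hy : y ∈ (Subgroup.zpowers (QuotientGroup.mk' M y)).comap (QuotientGroup.mk' M) :=
      Subgroup.mem_zpowers _
    rw [← h] at hy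
    have : QuotientGroup.mk' M y = 1 := (QuotientGroup.eq_one_iff y).mpr hy
    rw [this, orderOf_one] at hx
    omega
  have hx' : Subgroup.zpowers x = ⊤ := by
    rw [← Subgroup.map_comap_eq_self_of_surjective (QuotientGroup.mk'_surjective M)
      (Subgroup.zpowers x), htop, ← MonoidHom.range_eq_map]
    exact MonoidHom.range_eq_top.mpr (QuotientGroup.mk'_surjective M)
  rw [Subgroup.index_eq_card, ← hx, ← Nat.card_zpowers, hx', Subgroup.card_top]

/-- Cubes lie in the Frattini subgroup of a finite `3`-group. -/
theorem pow_three_mem_frattini {H : Type*} [Group H] [Finite H] (hH : IsPGroup 3 H) (x : H) :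
    x ^ 3 ∈ frattini H := by
  simp only [frattini, Order.radical, Subgroup.mem_iInf]
  intro M hM
  obtain ⟨hn, hi⟩ := IsCoatom.normal_index_three hH hM
  rw [← QuotientGroup.eq_one_iff, QuotientGroup.mk_pow, ← hi, Subgroup.index_eq_card]
  exact pow_card_eq_one'

/-- Commutators lie in the Frattini subgroup of a finite `3`-group. -/
theorem inv_mul_inv_mul_mul_mem_frattini {H : Type*} [Group H] [Finite H] (hH : IsPGroup 3 H)
    (x y : H) : x⁻¹ * y⁻¹ * x * y ∈ frattini H := by
  have : Fact (Nat.Prime 3) := ⟨Nat.prime_three⟩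
  simp only [frattini, Order.radical, Subgroup.mem_iInf]
  intro M hM
  obtain ⟨hn, hi⟩ := IsCoatom.normal_index_three hH hM
  rw [← QuotientGroup.eq_one_iff]
  rw [Subgroup.index_eq_card] at hi
  have := isCyclic_of_prime_card hi
  have hc : (x : H ⧸ M) * y = y * x :=
    (IsCyclic.isMulCommutative : IsMulCommutative (H ⧸ M)).is_comm.comm _ _
  rw [mul_assoc, QuotientGroup.mk_mul, QuotientGroup.mk_mul M x y, hc]
  simp [← mul_assoc]

/-- The order of the Frattini quotient, read off from an elementary abelian quotient whose kernel
consists of elements of the Frattini subgroup. -/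
theorem card_quotient_frattini {H V : Type*} [Group H] [Group V] {r : ℕ} {e : V →* H}
    (he : Function.Surjective e) {g : V →* Multiplicative (Fin r → ZMod 3)}
    (hg : Function.Surjective g) (hker : e.ker ≤ g.ker) (hfr : ∀ v, g v = 1 → e v ∈ frattini H) :
    Nat.card (H ⧸ frattini H) = 3 ^ r := by
  have hcomap : (frattini H).comap e = g.ker := by
    refine le_antisymm (fun v hv => ?_) (fun v hv => hfr v hv)
    have hf : ∀ i, frattini H ≤ ((AddMonoidHom.toMultiplicative
        (Pi.evalAddMonoidHom (fun _ : Fin r => ZMod 3) i)).comp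
          (e.liftOfSurjective he ⟨g, hker⟩)).ker := fun i => frattini_le_ker_zmod_three _
    have hl : e.liftOfSurjective he ⟨g, hker⟩ (e v) = g v :=
      MonoidHom.liftOfRightInverse_comp_apply _ _ _ _ _
    refine Multiplicative.toAdd.injective (funext fun i => ?_)
    have := hf i hv
    rw [MonoidHom.mem_ker, MonoidHom.comp_apply, hl] at this
    exact this
  rw [← Subgroup.index_eq_card, ← Subgroup.index_comap_of_surjective _ he, hcomap,
    Subgroup.index_ker, MonoidHom.range_eq_top.mpr hg, Subgroup.card_top]
  simp

/-- The logarithm of the order of the Frattini quotient of the centralizer of `g`. -/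
noncomputable def frattiniRank {G : Type*} [Group G] (g : G) : ℕ :=
  Nat.log 3 (Nat.card (↥(Subgroup.centralizer {g}) ⧸ frattini ↥(Subgroup.centralizer {g})))

theorem card_quotient_frattini_congr {H K : Type*} [Group H] [Group K] (f : H ≃* K) :
    Nat.card (H ⧸ frattini H) = Nat.card (K ⧸ frattini K) := by
  have h : (frattini K).comap f.toMonoidHom = frattini H := f.comapSubgroup.map_radical
  rw [← Subgroup.index_eq_card, ← Subgroup.index_eq_card, ← h]
  exact Subgroup.index_comap_of_surjective _ f.surjective

theorem map_conj_centralizer_singleton {G : Type*} [Group G] (g x : G) :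
    (Subgroup.centralizer {g}).map (MulAut.conj x).toMonoidHom =
      Subgroup.centralizer {x * g * x⁻¹} := by
  ext y
  simp only [Subgroup.mem_map, Subgroup.mem_centralizer_singleton_iff]
  constructor
  · rintro ⟨u, hu, rfl⟩
    have : x * (u * g) * x⁻¹ = x * (g * u) * x⁻¹ := by rw [hu]
    simpa [mul_assoc] using this
  · intro hy
    refine ⟨x⁻¹ * y * x, ?_, by simp [mul_assoc]⟩
    have : x⁻¹ * (y * (x * g * x⁻¹)) * x = x⁻¹ * (x * g * x⁻¹ * y) * x := by rw [hy]
    simpa [mul_assoc] using this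

theorem frattiniRank_conj {G : Type*} [Group G] (g x : G) :
    frattiniRank (x * g * x⁻¹) = frattiniRank g := by
  unfold frattiniRank
  rw [← map_conj_centralizer_singleton]
  congr 1
  exact (card_quotient_frattini_congr
    ((Subgroup.centralizer {g}).equivMapOfInjective _ (MulAut.conj x).injective)).symm

theorem card_centralizer_singleton_conj {G : Type*} [Group G] (g x : G) :
    Nat.card (Subgroup.centralizer {x * g * x⁻¹}) = Nat.card (Subgroup.centralizer {g}) := by
  rw [← map_conj_centralizer_singleton]
  exact (Nat.card_congr ((Subgroup.centralizer {g}).equivMapOfInjective _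
    (MulAut.conj x).injective).toEquiv).symm

/-- `S(G)` as an average over the elements of `G`. -/
theorem card_mul_SInvariant {G : Type*} [Group G] [Fintype G] :
    Nat.card G * SInvariant G =
      ∑ g : G, frattiniRank g * Nat.card (Subgroup.centralizer {g}) := by
  classical
  have hrep : ∀ C : ConjClasses G, ConjClasses.mk (ConjClasses.exists_rep C).choose = C :=
    fun C => (ConjClasses.exists_rep C).choose_spec
  have hS : SInvariant G = ∑ C : ConjClasses G, frattiniRank (ConjClasses.exists_rep C).choose :=
    finsum_eq_sum_of_fintype _
  rw [hS, Finset.mul_sum, ← Finset.sum_fiberwise (s := Finset.univ) (g := (ConjClasses.mk : G → _))]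
  refine Finset.sum_congr rfl fun C _ => ?_
  set g₀ := (ConjClasses.exists_rep C).choose with hg₀
  have hconst : ∀ g ∈ Finset.univ.filter (fun g : G => ConjClasses.mk g = C),
      frattiniRank g * Nat.card (Subgroup.centralizer {g}) =
        frattiniRank g₀ * Nat.card (Subgroup.centralizer {g₀}) := by
    intro g hg
    have hg' : ConjClasses.mk g₀ = ConjClasses.mk g :=
      (hrep C).trans (Finset.mem_filter.mp hg).2.symm
    obtain ⟨x, rfl⟩ := isConj_iff.mp (ConjClasses.mk_eq_mk_iff_isConj.mp hg')
    rw [frattiniRank_conj, card_centralizer_singleton_conj]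
  rw [Finset.sum_congr rfl hconst, Finset.sum_const, smul_eq_mul]
  have hcard : Nat.card G = (Finset.univ.filter (fun g : G => ConjClasses.mk g = C)).card *
      Nat.card (Subgroup.centralizer {g₀}) := by
    rw [Subgroup.nat_card_centralizer_nat_card_stabilizer, Nat.card_eq_fintype_card,
      Nat.card_eq_fintype_card, Fintype.card_congr (ConjAct.toConjAct (G := G)).toEquiv,
      ← MulAction.card_orbit_mul_card_stabilizer_eq_card_group (ConjAct G) g₀]
    congr 1
    rw [← Fintype.card_coe]
    refine Fintype.card_congr (Equiv.subtypeEquivRight fun g => ?_)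
    rw [ConjAct.orbit_eq_carrier_conjClasses, ConjClasses.mem_carrier_iff_mk_eq, hrep C]
    simp
  rw [hcard]
  ring

theorem Int.dvd_of_eq_of_dvd {a b c : ℤ} (h : c = b) (hb : a ∣ b) : a ∣ c := h ▸ hb

/-- Integers `p`, `q`, `z₁`, `z₂` such that the subgroup `⟨c, d⟩` of `T2(n)` is presented as an
abelian group by `c ^ p = d ^ q = 1`, and such that `z = c ^ z₁ * d ^ z₂`. -/
structure T2Params (n p q : ℕ) (z₁ z₂ : ℤ) : Prop where
  mul_eq : p * q = 3 ^ (n - 2)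
  three_dvd : (3 : ℤ) ∣ q
  q_dvd : (q : ℤ) ∣ p
  p_dvd : (p : ℤ) ∣ 3 * q
  q_dvd_z : (q : ℤ) ∣ z₁
  p_dvd_z : (p : ℤ) ∣ 3 * z₁ - 3 * z₂
  exists_of_dvd : ∀ x y : ℤ, (p : ℤ) ∣ 3 * y → (q : ℤ) ∣ x - 3 * y →
    ∃ t : ℤ, (p : ℤ) ∣ x - t * z₁ ∧ (q : ℤ) ∣ y - t * z₂
  z_ne : ¬ ((p : ℤ) ∣ z₁ ∧ (q : ℤ) ∣ z₂)

/-- The lattice of exponents `(i, x, y)` with `b ^ i * c ^ x * d ^ y = 1` in `T2(n)`. -/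
def relLattice (p q : ℕ) (z₁ z₂ : ℤ) : AddSubgroup (ℤ × ℤ × ℤ) where
  carrier := {v | ∃ k : ℤ, v.1 = 3 * k ∧ (p : ℤ) ∣ v.2.1 - k * (3 - z₁) ∧
    (q : ℤ) ∣ v.2.2 - k * (1 - z₂)}
  zero_mem' := ⟨0, by simp⟩
  add_mem' := by
    rintro ⟨i, x, y⟩ ⟨i', x', y'⟩ ⟨k, h, s, t⟩ ⟨k', h', s', t'⟩
    refine ⟨k + k', ?_, ?_, ?_⟩
    · simp only [Prod.mk_add_mk] at *
      omega
    · refine Int.dvd_of_eq_of_dvd ?_ (s.add s')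
      simp only [Prod.mk_add_mk]
      ring
    · refine Int.dvd_of_eq_of_dvd ?_ (t.add t')
      simp only [Prod.mk_add_mk]
      ring
  neg_mem' := by
    rintro ⟨i, x, y⟩ ⟨k, h, s, t⟩
    refine ⟨-k, ?_, ?_, ?_⟩
    · simp only [Prod.neg_mk] at *
      omega
    · refine Int.dvd_of_eq_of_dvd ?_ (s.neg_right)
      simp only [Prod.neg_mk]
      ring
    · refine Int.dvd_of_eq_of_dvd ?_ (t.neg_right)
      simp only [Prod.neg_mk]
      ring

theorem mem_relLattice {p q : ℕ} {z₁ z₂ i x y : ℤ} :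
    (i, x, y) ∈ relLattice p q z₁ z₂ ↔ ∃ k : ℤ, i = 3 * k ∧ (p : ℤ) ∣ x - k * (3 - z₁) ∧
      (q : ℤ) ∣ y - k * (1 - z₂) :=
  Iff.rfl

theorem mem_relLattice_zero {p q : ℕ} {z₁ z₂ x y : ℤ} :
    ((0, x, y) : ℤ × ℤ × ℤ) ∈ relLattice p q z₁ z₂ ↔ (p : ℤ) ∣ x ∧ (q : ℤ) ∣ y := by
  rw [mem_relLattice]
  constructor
  · rintro ⟨k, hk, hx, hy⟩
    obtain rfl : k = 0 := by omega
    simpa using And.intro hx hy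
  · rintro ⟨hx, hy⟩
    exact ⟨0, by simp, by simpa using hx, by simpa using hy⟩

/-- The action of `u ↦ a * u * a⁻¹` on the exponents of `b`, `c`, `d`. -/
def conjExp : ℤ × ℤ × ℤ →+ ℤ × ℤ × ℤ where
  toFun v := (v.1, 2 * v.1 - 2 * v.2.1 + 3 * v.2.2, v.1 - v.2.1 + v.2.2)
  map_zero' := by simp
  map_add' v w := by
    ext <;> simp <;> ring

theorem conjExp_mk (i x y : ℤ) :
    conjExp (i, x, y) = (i, 2 * i - 2 * x + 3 * y, i - x + y) := rfl

theorem conjExp_conjExp_conjExp (v : ℤ × ℤ × ℤ) : conjExp (conjExp (conjExp v)) = v := by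
  obtain ⟨i, x, y⟩ := v
  simp only [conjExp_mk, Prod.mk.injEq]
  refine ⟨trivial, ?_, ?_⟩ <;> ring

theorem T2Params.conjExp_mem {n p q : ℕ} {z₁ z₂ : ℤ} (P : T2Params n p q z₁ z₂)
    {v : ℤ × ℤ × ℤ} (hv : v ∈ relLattice p q z₁ z₂) : conjExp v ∈ relLattice p q z₁ z₂ := by
  obtain ⟨i, x, y⟩ := v
  obtain ⟨k, rfl, hx, hy⟩ := mem_relLattice.mp hv
  rw [conjExp_mk, mem_relLattice]
  refine ⟨k, rfl, ?_, ?_⟩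
  · refine Int.dvd_of_eq_of_dvd ?_ (((hx.mul_left (-2)).add
      (P.p_dvd.trans (mul_dvd_mul_left 3 hy))).add (P.p_dvd_z.mul_left k))
    ring
  · refine Int.dvd_of_eq_of_dvd ?_ (((P.q_dvd.trans hx).neg_right.add hy).add
      (P.q_dvd_z.mul_left k))
    ring

/-- A quotient map from the group `T2(n)` in coordinates: `e (i, x, y)` stands for
`b ^ i * c ^ x * d ^ y`. -/
structure T2Hom (p q : ℕ) (z₁ z₂ : ℤ) (G : Type*) [Group G] where
  a : G
  e : Multiplicative (ℤ × ℤ × ℤ) →* G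
  a_pow : a ^ 3 = 1
  conj : ∀ v, a * e (.ofAdd v) * a⁻¹ = e (.ofAdd (conjExp v))
  e_eq_one : ∀ v ∈ relLattice p q z₁ z₂, e (.ofAdd v) = 1

theorem map_gpComm {G H : Type*} [Group G] [Group H] (f : G →* H) (x y : G) :
    f (gpComm x y) = gpComm (f x) (f y) := by
  simp [gpComm]

section

open Multiplicative

theorem T2Hom.lift_eq_one {n p q : ℕ} {z₁ z₂ : ℤ}
    (hK : (if Even n then {MaxClass3.c ^ 3 ^ ((n - 2) / 2), MaxClass3.d ^ 3 ^ ((n - 2) / 2)}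
      else {MaxClass3.c ^ 3 ^ ((n - 1) / 2), MaxClass3.d ^ 3 ^ ((n - 3) / 2)}) =
      ({MaxClass3.c ^ p, MaxClass3.d ^ q} : Set (FreeGroup (Fin 4))))
    (hz : MaxClass3.zWord n = MaxClass3.c ^ z₁ * MaxClass3.d ^ z₂)
    {G : Type*} [Group G] (D : T2Hom p q z₁ z₂ G) :
    ∀ r ∈ MaxClass3.T2rels n, FreeGroup.lift
      ![D.a, D.e (ofAdd (1, 0, 0)), D.e (ofAdd (0, 1, 0)), D.e (ofAdd (0, 0, 1))] r = 1 := by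
  have hconj : ∀ v, D.a⁻¹ * D.e (ofAdd v) * D.a = D.e (ofAdd (conjExp (conjExp v))) := by
    intro v
    rw [← D.conj, ← D.conj]
    have h : D.a * D.a = D.a⁻¹ := by
      rw [eq_inv_iff_mul_eq_one, ← D.a_pow, pow_succ, pow_two]
    have h' : D.a⁻¹ * D.a⁻¹ = D.a := by rw [← mul_inv_rev, h, inv_inv]
    calc _ = D.a⁻¹ * D.e (ofAdd v) * (D.a⁻¹ * D.a⁻¹) := by rw [h']
      _ = (D.a * D.a) * D.e (ofAdd v) * (D.a⁻¹ * D.a⁻¹) := by rw [h]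
      _ = _ := by simp only [mul_assoc]
  have hcomm : ∀ v, gpComm (D.e (ofAdd v)) D.a = D.e (ofAdd (conjExp (conjExp v) - v)) := by
    intro v
    rw [gpComm, mul_assoc, mul_assoc, ← mul_assoc D.a⁻¹, hconj, ← map_inv, ← map_mul, ← ofAdd_neg,
      ← ofAdd_add]
    congr 2
    abel
  have hcomm' : ∀ v w, gpComm (D.e (ofAdd v)) (D.e (ofAdd w)) = 1 := by
    intro v w
    rw [gpComm, ← map_inv D.e, ← map_inv D.e, ← map_mul, ← map_mul, ← map_mul, mul_assoc, mul_comm,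
      mul_assoc]
    simp
  intro r hr
  rw [MaxClass3.T2rels, MaxClass3.Krels, hK, hz] at hr
  simp only [Set.mem_union, Set.mem_insert_iff, Set.mem_singleton_iff] at hr
  rcases hr with ((rfl | rfl | rfl | rfl | rfl) | (rfl | rfl)) | (rfl | rfl | rfl) <;>
    simp only [map_mul, map_inv, map_pow, map_zpow, map_gpComm, FreeGroup.lift_apply_of] <;>
    simp only [Matrix.cons_val, hcomm, hcomm', D.a_pow, ← map_pow, ← map_zpow, ← map_inv, ← map_mul,
      ← ofAdd_neg, ← ofAdd_add, ← ofAdd_nsmul, ← ofAdd_zsmul] <;>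
    refine D.e_eq_one _ ?_ <;>
    simp only [conjExp_mk, Prod.mk_sub_mk, Prod.mk_add_mk, Prod.neg_mk, Prod.smul_mk] <;>
    simp [mem_relLattice_zero]
  refine mem_relLattice.mpr ⟨1, by simp, ?_, ?_⟩ <;> ring_nf <;> simp

/-- A group with the coordinates of `T2(n)`, together with its abelianization map. -/
structure T2Data (p q : ℕ) (z₁ z₂ : ℤ) (G : Type*) [Group G] extends T2Hom p q z₁ z₂ G where
  χ : G →* Multiplicative (Fin 2 → ZMod 3)
  mem_of_e_eq_one : ∀ v, e (.ofAdd v) = 1 → v ∈ relLattice p q z₁ z₂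
  exists_eq : ∀ g, ∃ v, ∃ k < 3, g = e (.ofAdd v) * a ^ k
  χ_a : χ a = .ofAdd ![1, 0]
  χ_e : ∀ v, χ (e (.ofAdd v)) = .ofAdd ![0, v.1]

/-- The abelianization map of `T2(n)` in coordinates. -/
def T2Hom.abelianization (p q : ℕ) (z₁ z₂ : ℤ) :
    T2Hom p q z₁ z₂ (Multiplicative (Fin 2 → ZMod 3)) where
  a := ofAdd ![1, 0]
  e := AddMonoidHom.toMultiplicative
    { toFun := fun v => ![0, (v.1 : ZMod 3)]
      map_zero' := by simp
      map_add' := by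
        intro v w
        ext i
        fin_cases i <;> simp }
  a_pow := by
    rw [← ofAdd_nsmul]
    decide
  conj v := by
    rw [mul_comm, inv_mul_cancel_left]
    rfl
  e_eq_one := by
    rintro ⟨i, x, y⟩ ⟨k, hk, -, -⟩
    dsimp only at hk
    subst hk
    have h : ((3 * k : ℤ) : ZMod 3) = 0 := (ZMod.intCast_zmod_eq_zero_iff_dvd _ 3).mpr ⟨k, by simp⟩
    refine congrArg ofAdd (funext fun i => ?_)
    fin_cases i
    · rfl
    · exact h

/-- The automorphism induced by `conjExp` on the quotient by the lattice of relations. -/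
def T2Params.conjExpQuot {n p q : ℕ} {z₁ z₂ : ℤ} (P : T2Params n p q z₁ z₂) :
    (ℤ × ℤ × ℤ) ⧸ relLattice p q z₁ z₂ →+ (ℤ × ℤ × ℤ) ⧸ relLattice p q z₁ z₂ :=
  QuotientAddGroup.map _ _ conjExp fun _ hv => P.conjExp_mem hv

theorem T2Params.conjExpQuot_mk {n p q : ℕ} {z₁ z₂ : ℤ} (P : T2Params n p q z₁ z₂)
    (v : ℤ × ℤ × ℤ) : P.conjExpQuot v = ((conjExp v : ℤ × ℤ × ℤ) : _ ⧸ relLattice p q z₁ z₂) :=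
  rfl

theorem T2Params.conjExpQuot_conjExpQuot_conjExpQuot {n p q : ℕ} {z₁ z₂ : ℤ}
    (P : T2Params n p q z₁ z₂) (w : (ℤ × ℤ × ℤ) ⧸ relLattice p q z₁ z₂) :
    P.conjExpQuot (P.conjExpQuot (P.conjExpQuot w)) = w := by
  induction w using QuotientAddGroup.induction_on with
  | H v => rw [P.conjExpQuot_mk, P.conjExpQuot_mk, P.conjExpQuot_mk, conjExp_conjExp_conjExp]

/-- The affine action of `T2(n)` on its abelian maximal subgroup. -/
def T2Hom.affine {n p q : ℕ} {z₁ z₂ : ℤ} (P : T2Params n p q z₁ z₂) :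
    T2Hom p q z₁ z₂ (Equiv.Perm ((ℤ × ℤ × ℤ) ⧸ relLattice p q z₁ z₂)) where
  a :=
    { toFun := P.conjExpQuot
      invFun := fun w => P.conjExpQuot (P.conjExpQuot w)
      left_inv := P.conjExpQuot_conjExpQuot_conjExpQuot
      right_inv := P.conjExpQuot_conjExpQuot_conjExpQuot }
  e := MonoidHom.mk' (fun v => Equiv.addLeft ((toAdd v : ℤ × ℤ × ℤ) :
    (ℤ × ℤ × ℤ) ⧸ relLattice p q z₁ z₂)) (by
      intro v w
      ext u
      simp)
  a_pow := by
    ext w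
    simp [pow_succ, P.conjExpQuot_conjExpQuot_conjExpQuot]
  conj v := by
    rw [mul_inv_eq_iff_eq_mul]
    ext w
    simp [P.conjExpQuot_mk]
  e_eq_one v hv := by
    ext w
    have : ((v : ℤ × ℤ × ℤ) : (ℤ × ℤ × ℤ) ⧸ relLattice p q z₁ z₂) = 0 :=
      (QuotientAddGroup.eq_zero_iff v).mpr hv
    simp [this]

/-- Presentation data expressing `T2(n)` through the parameters `p`, `q`, `z₁`, `z₂`. -/
structure T2Words (n p q : ℕ) (z₁ z₂ : ℤ) : Prop where
  exponents : (if Even n then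
      {MaxClass3.c ^ 3 ^ ((n - 2) / 2), MaxClass3.d ^ 3 ^ ((n - 2) / 2)}
    else {MaxClass3.c ^ 3 ^ ((n - 1) / 2), MaxClass3.d ^ 3 ^ ((n - 3) / 2)}) =
      ({MaxClass3.c ^ p, MaxClass3.d ^ q} : Set (FreeGroup (Fin 4)))
  zWord_eq : MaxClass3.zWord n = MaxClass3.c ^ z₁ * MaxClass3.d ^ z₂

/-- The tautological coordinates on a group generated as in the presentation of `T2(n)`. -/
theorem T2Hom.exists_of_relations {p q : ℕ} {z₁ z₂ : ℤ} {G : Type*} [Group G] {a b c d : G}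
    (hc : c⁻¹ * gpComm b a = 1) (hd : d⁻¹ * gpComm c a = 1) (hda : gpComm d a * d ^ 3 * c ^ 3 = 1)
    (hdb : gpComm d b = 1) (hdc : gpComm d c = 1) (hp : c ^ p = 1) (hq : d ^ q = 1)
    (ha : a ^ 3 = 1) (hb : b ^ 3 * (c ^ z₁ * d ^ z₂)⁻¹ * d * c ^ 3 = 1) (hcb : gpComm c b = 1) :
    ∃ D : T2Hom p q z₁ z₂ G, D.a = a ∧
      ∀ v : ℤ × ℤ × ℤ, D.e (ofAdd v) = b ^ v.1 * c ^ v.2.1 * d ^ v.2.2 := by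
  have comm_of : ∀ x y : G, gpComm x y = 1 → Commute x y := by
    intro x y h
    have : x⁻¹ * y⁻¹ * x * y = (y * x)⁻¹ * (x * y) := by group
    rw [gpComm, this, inv_mul_eq_one] at h
    exact h.symm
  replace hdb : Commute d b := comm_of _ _ hdb
  replace hdc : Commute d c := comm_of _ _ hdc
  replace hcb : Commute c b := comm_of _ _ hcb
  let e : Multiplicative (ℤ × ℤ × ℤ) →* G := MonoidHom.mk'
    (fun v => b ^ (toAdd v).1 * c ^ (toAdd v).2.1 * d ^ (toAdd v).2.2) (by
      intro v w
      simp only [toAdd_mul, Prod.fst_add, Prod.snd_add, zpow_add]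
      have h1 := (hcb.zpow_zpow (toAdd v).2.1 (toAdd w).1).eq
      have h2 := (hdb.zpow_zpow (toAdd v).2.2 (toAdd w).1).eq
      have h3 := (hdc.zpow_zpow (toAdd v).2.2 (toAdd w).2.1).eq
      generalize b ^ (toAdd v).1 = b₁, b ^ (toAdd w).1 = b₂ at *
      generalize c ^ (toAdd v).2.1 = c₁, c ^ (toAdd w).2.1 = c₂ at *
      generalize d ^ (toAdd v).2.2 = d₁, d ^ (toAdd w).2.2 = d₂ at *
      calc _ = b₁ * (b₂ * c₁) * c₂ * d₁ * d₂ := by simp only [mul_assoc]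
        _ = b₁ * c₁ * b₂ * (c₂ * d₁) * d₂ := by rw [← h1]; simp only [mul_assoc]
        _ = b₁ * c₁ * (b₂ * d₁) * c₂ * d₂ := by rw [← h3]; simp only [mul_assoc]
        _ = _ := by rw [← h2]; simp only [mul_assoc])
  have he : ∀ i x y : ℤ, e (ofAdd (i, x, y)) = b ^ i * c ^ x * d ^ y := fun i x y => rfl
  have heb : b = e (ofAdd (1, 0, 0)) := by simp [he]
  have hec : c = e (ofAdd (0, 1, 0)) := by simp [he]
  have hed : d = e (ofAdd (0, 0, 1)) := by simp [he]
  have hab : a⁻¹ * b * a = e (ofAdd (1, 1, 0)) := by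
    have : a⁻¹ * b * a = b * c * (c⁻¹ * gpComm b a) := by rw [gpComm]; group
    rw [this, hc, mul_one, he]
    simp
  have hac : a⁻¹ * c * a = e (ofAdd (0, 1, 1)) := by
    have : a⁻¹ * c * a = c * d * (d⁻¹ * gpComm c a) := by rw [gpComm]; group
    rw [this, hd, mul_one, he]
    simp
  have had : a⁻¹ * d * a = e (ofAdd (0, -3, -2)) := by
    have : a⁻¹ * d * a = d * (gpComm d a * d ^ 3 * c ^ 3) * (d ^ 3 * c ^ 3)⁻¹ := by
      rw [gpComm]; group
    rw [this, hda, mul_one, hec, hed, ← map_pow e, ← map_pow e, ← map_mul e, ← map_inv e,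
      ← map_mul e]
    rfl
  have hconj : ∀ i x y : ℤ, a⁻¹ * e (ofAdd (i, x, y)) * a =
      e (ofAdd (i, i + x - 3 * y, x - 2 * y)) := by
    intro i x y
    have : a⁻¹ * e (ofAdd (i, x, y)) * a =
        (a⁻¹ * b * a) ^ i * (a⁻¹ * c * a) ^ x * (a⁻¹ * d * a) ^ y := by
      have hz : ∀ (g : G) (m : ℤ), (a⁻¹ * g * a) ^ m = a⁻¹ * g ^ m * a := by
        intro g m
        simpa using conj_zpow (a := a⁻¹) (b := g) (i := m)
      rw [hz, hz, hz, he]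
      group
    rw [this, hab, hac, had, ← map_zpow e, ← map_zpow e, ← map_zpow e, ← map_mul e, ← map_mul e]
    congr 1
    refine toAdd.injective ?_
    ext <;> simp <;> ring
  refine ⟨⟨a, e, ha, ?_, ?_⟩, rfl, fun v => rfl⟩
  · rintro ⟨i, x, y⟩
    have h := hconj i (2 * i - 2 * x + 3 * y) (i - x + y)
    have h' : (i, i + (2 * i - 2 * x + 3 * y) - 3 * (i - x + y),
        2 * i - 2 * x + 3 * y - 2 * (i - x + y)) = (i, x, y) := by
      ext <;> simp <;> ring
    rw [h'] at h
    rw [conjExp_mk, ← h]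
    group
  · rintro ⟨i, x, y⟩ hv
    obtain ⟨k, rfl, ⟨s, hs⟩, ⟨t, ht⟩⟩ := mem_relLattice.mp hv
    have hw : e (ofAdd (3, 3 - z₁, 1 - z₂)) = 1 := by
      rw [← hb, hec, hed, heb]
      simp only [← map_pow, ← map_zpow, ← map_mul, ← map_inv]
      congr 1
      refine toAdd.injective ?_
      ext <;> simp
      all_goals ring
    have : ofAdd ((3 * k, x, y) : ℤ × ℤ × ℤ) = ofAdd (3, 3 - z₁, 1 - z₂) ^ k *
        (ofAdd (0, 1, 0) ^ p) ^ s * (ofAdd (0, 0, 1) ^ q) ^ t := by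
      refine toAdd.injective ?_
      ext <;> simp
      all_goals linarith
    rw [this, map_mul, map_mul, map_zpow, map_zpow, map_zpow, map_pow, map_pow, hw, ← hec, ← hed,
      hp, hq]
    simp

theorem T2Hom.a_mul {p q : ℕ} {z₁ z₂ : ℤ} {G : Type*} [Group G] (D : T2Hom p q z₁ z₂ G)
    (k : ℕ) (v : ℤ × ℤ × ℤ) :
    D.a ^ k * D.e (ofAdd v) = D.e (ofAdd (conjExp^[k] v)) * D.a ^ k := by
  induction k generalizing v with
  | zero => simp
  | succ k ih =>
    rw [pow_succ, Function.iterate_succ_apply, mul_assoc, ← mul_assoc _ (D.a ^ k), ← ih, mul_assoc,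
      ← D.conj]
    group

theorem T2Data.nonempty {n p q : ℕ} {z₁ z₂ : ℤ} (P : T2Params n p q z₁ z₂)
    (W : T2Words n p q z₁ z₂) : Nonempty (T2Data p q z₁ z₂ (MaxClass3.T2 n)) := by
  obtain ⟨Q, hQ⟩ : ∃ Q : FreeGroup (Fin 4) → Prop,
      Q = fun r => PresentedGroup.mk (MaxClass3.T2rels n) r = 1 := ⟨_, rfl⟩
  have hrel : ∀ r ∈ MaxClass3.T2rels n, Q r := by
    rw [hQ]
    exact fun r hr => PresentedGroup.one_of_mem hr
  simp only [MaxClass3.T2rels, MaxClass3.Krels, W.exponents, W.zWord_eq, Set.mem_union,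
    Set.mem_insert_iff, Set.mem_singleton_iff, or_imp, forall_and, forall_eq] at hrel
  obtain ⟨⟨⟨h1, h2, h3, h4, h5⟩, h6, h7⟩, h8, h9, h10⟩ := hrel
  rw [hQ] at h1 h2 h3 h4 h5 h6 h7 h8 h9 h10
  simp only [map_gpComm, map_mul, map_pow, map_inv, map_zpow] at h1 h2 h3 h4 h5 h6 h7 h8 h9 h10
  obtain ⟨D, hDa, hDe⟩ := T2Hom.exists_of_relations h1 h2 h3 h4 h5 h6 h7 h8 h9 h10
  have key : ∀ {G : Type} [Group G] (F : T2Hom p q z₁ z₂ G), ∃ Φ : MaxClass3.T2 n →* G,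
      Φ D.a = F.a ∧ ∀ v, Φ (D.e (ofAdd v)) = F.e (ofAdd v) := by
    intro G _ F
    have hF := T2Hom.lift_eq_one W.exponents W.zWord_eq F
    refine ⟨PresentedGroup.toGroup hF, ?_, ?_⟩
    · rw [hDa]
      exact PresentedGroup.toGroup.of hF
    · rintro ⟨i, x, y⟩
      rw [hDe, map_mul, map_mul, map_zpow, map_zpow, map_zpow]
      have hb : PresentedGroup.toGroup hF (PresentedGroup.mk _ MaxClass3.b) =
        F.e (ofAdd (1, 0, 0)) := PresentedGroup.toGroup.of hF
      have hc : PresentedGroup.toGroup hF (PresentedGroup.mk _ MaxClass3.c) =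
        F.e (ofAdd (0, 1, 0)) := PresentedGroup.toGroup.of hF
      have hd : PresentedGroup.toGroup hF (PresentedGroup.mk _ MaxClass3.d) =
        F.e (ofAdd (0, 0, 1)) := PresentedGroup.toGroup.of hF
      rw [hb, hc, hd, ← map_zpow F.e, ← map_zpow F.e, ← map_zpow F.e, ← map_mul F.e,
        ← map_mul F.e]
      congr 1
      refine toAdd.injective ?_
      ext <;> simp
  obtain ⟨χ, hχa, hχe⟩ := key (T2Hom.abelianization p q z₁ z₂)
  obtain ⟨Φ, -, hΦ⟩ := key (T2Hom.affine P)
  refine ⟨⟨D, χ, ?_, ?_, hχa, hχe⟩⟩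
  · intro v hv
    have h := hΦ v
    rw [hv, map_one] at h
    have h' := congrArg (fun σ => σ 0) h
    rw [← QuotientAddGroup.eq_zero_iff]
    simpa [T2Hom.affine] using h'.symm
  · let H : Subgroup (MaxClass3.T2 n) :=
      { carrier := {g | ∃ v, ∃ k : ℕ, g = D.e (ofAdd v) * D.a ^ k}
        one_mem' := ⟨0, 0, by simp⟩
        mul_mem' := by
          rintro _ _ ⟨v, k, rfl⟩ ⟨w, l, rfl⟩
          refine ⟨v + conjExp^[k] w, k + l, ?_⟩
          rw [mul_assoc, ← mul_assoc (D.a ^ k), D.a_mul, ofAdd_add, map_mul, pow_add]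
          simp only [mul_assoc]
        inv_mem' := by
          rintro _ ⟨v, k, rfl⟩
          refine ⟨conjExp^[2 * k] (-v), 2 * k, ?_⟩
          rw [← D.a_mul, mul_inv_rev, ofAdd_neg, map_inv]
          congr 1
          rw [inv_eq_iff_mul_eq_one, ← pow_add, show k + 2 * k = 3 * k by ring, pow_mul, D.a_pow,
            one_pow] }
    intro g
    have hg : g ∈ H := by
      refine PresentedGroup.generated_by _ H ?_ g
      intro j
      fin_cases j
      · exact ⟨0, 1, by simp [hDa]; rfl⟩
      · exact ⟨(1, 0, 0), 0, by simp [hDe]; rfl⟩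
      · exact ⟨(0, 1, 0), 0, by simp [hDe]; rfl⟩
      · exact ⟨(0, 0, 1), 0, by simp [hDe]; rfl⟩
    obtain ⟨v, k, rfl⟩ := hg
    refine ⟨v, k % 3, Nat.mod_lt _ (by norm_num), ?_⟩
    congr 1
    conv_lhs => rw [← Nat.div_add_mod k 3, pow_add, pow_mul, D.a_pow, one_pow, one_mul]

theorem T2Data.e_eq_one_iff {p q : ℕ} {z₁ z₂ : ℤ} {G : Type*} [Group G] (D : T2Data p q z₁ z₂ G)
    (v : ℤ × ℤ × ℤ) : D.e (ofAdd v) = 1 ↔ v ∈ relLattice p q z₁ z₂ :=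
  ⟨D.mem_of_e_eq_one v, D.e_eq_one v⟩

theorem T2Data.e_eq_iff {p q : ℕ} {z₁ z₂ : ℤ} {G : Type*} [Group G] (D : T2Data p q z₁ z₂ G)
    (v w : ℤ × ℤ × ℤ) : D.e (ofAdd v) = D.e (ofAdd w) ↔ v - w ∈ relLattice p q z₁ z₂ := by
  rw [← D.e_eq_one_iff, ofAdd_sub, map_div, div_eq_one]

/-- The characters of order `3` of `T2(n)` given by the exponents of `a` and `b`. -/
def T2Data.char {p q : ℕ} {z₁ z₂ : ℤ} {G : Type*} [Group G] (D : T2Data p q z₁ z₂ G)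
    (j : Fin 2) : G →* Multiplicative (ZMod 3) :=
  (AddMonoidHom.toMultiplicative (Pi.evalAddMonoidHom (fun _ : Fin 2 => ZMod 3) j)).comp D.χ

theorem T2Data.χ_mk {p q : ℕ} {z₁ z₂ : ℤ} {G : Type*} [Group G] (D : T2Data p q z₁ z₂ G)
    (v : ℤ × ℤ × ℤ) (k : ℕ) :
    D.χ (D.e (ofAdd v) * D.a ^ k) = ofAdd ![(k : ZMod 3), (v.1 : ZMod 3)] := by
  rw [map_mul, map_pow, D.χ_a, D.χ_e, ← ofAdd_nsmul, ← ofAdd_add]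
  simp

theorem T2Data.char_zero_mk {p q : ℕ} {z₁ z₂ : ℤ} {G : Type*} [Group G] (D : T2Data p q z₁ z₂ G)
    (v : ℤ × ℤ × ℤ) (k : ℕ) : D.char 0 (D.e (ofAdd v) * D.a ^ k) = ofAdd (k : ZMod 3) := by
  rw [T2Data.char, MonoidHom.comp_apply, D.χ_mk]
  rfl

theorem T2Data.char_one_mk {p q : ℕ} {z₁ z₂ : ℤ} {G : Type*} [Group G] (D : T2Data p q z₁ z₂ G)
    (v : ℤ × ℤ × ℤ) (k : ℕ) : D.char 1 (D.e (ofAdd v) * D.a ^ k) = ofAdd (v.1 : ZMod 3) := by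
  rw [T2Data.char, MonoidHom.comp_apply, D.χ_mk]
  rfl

theorem T2Data.χ_eq_one_iff {p q : ℕ} {z₁ z₂ : ℤ} {G : Type*} [Group G] (D : T2Data p q z₁ z₂ G)
    (g : G) : D.χ g = 1 ↔ D.char 0 g = 1 ∧ D.char 1 g = 1 := by
  constructor
  · intro h
    simp [T2Data.char, h]
  · rintro ⟨h0, h1⟩
    refine toAdd.injective (funext fun j => ?_)
    fin_cases j
    · exact h0
    · exact h1

theorem T2Data.χ_surjective {p q : ℕ} {z₁ z₂ : ℤ} {G : Type*} [Group G]
    (D : T2Data p q z₁ z₂ G) : Function.Surjective D.χ := by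
  intro f
  refine ⟨D.e (ofAdd ((toAdd f 1).val, 0, 0)) * D.a ^ (toAdd f 0).val, ?_⟩
  rw [D.χ_mk]
  refine toAdd.injective (funext fun j => ?_)
  fin_cases j <;> simp

theorem T2Data.char_surjective {p q : ℕ} {z₁ z₂ : ℤ} {G : Type*} [Group G]
    (D : T2Data p q z₁ z₂ G) (j : Fin 2) : Function.Surjective (D.char j) :=
  Function.Surjective.comp (g := fun f : Multiplicative (Fin 2 → ZMod 3) => ofAdd (toAdd f j))
    (fun t => ⟨ofAdd fun _ => toAdd t, rfl⟩) D.χ_surjective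

theorem T2Data.char_zero_eq_one_iff {p q : ℕ} {z₁ z₂ : ℤ} {G : Type*} [Group G]
    (D : T2Data p q z₁ z₂ G) (g : G) : D.char 0 g = 1 ↔ ∃ v, g = D.e (ofAdd v) := by
  constructor
  · intro h
    obtain ⟨v, k, hk, rfl⟩ := D.exists_eq g
    rw [D.char_zero_mk, ofAdd_eq_one, ZMod.natCast_eq_zero_iff] at h
    obtain rfl : k = 0 := by omega
    exact ⟨v, by simp⟩
  · rintro ⟨v, rfl⟩
    simpa using D.char_zero_mk v 0

theorem T2Data.exists_mk_eq {p q : ℕ} {z₁ z₂ : ℤ} {G : Type*} [Group G]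
    (D : T2Data p q z₁ z₂ G) (m x y : ℤ) :
    ∃ x' y', D.e (ofAdd (3 * m, x, y)) = D.e (ofAdd (0, x', y')) := by
  refine ⟨x - m * (3 - z₁), y - m * (1 - z₂), ?_⟩
  rw [D.e_eq_iff]
  exact ⟨m, by simp, by simp, by simp⟩

theorem T2Data.char_one_e {p q : ℕ} {z₁ z₂ : ℤ} {G : Type*} [Group G]
    (D : T2Data p q z₁ z₂ G) (v : ℤ × ℤ × ℤ) : D.char 1 (D.e (ofAdd v)) = ofAdd (v.1 : ZMod 3) := by
  simpa using D.char_one_mk v 0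

theorem T2Data.mem_ker_χ_iff {p q : ℕ} {z₁ z₂ : ℤ} {G : Type*} [Group G]
    (D : T2Data p q z₁ z₂ G) (g : G) : g ∈ D.χ.ker ↔ ∃ x y, g = D.e (ofAdd (0, x, y)) := by
  rw [MonoidHom.mem_ker]
  constructor
  · intro h
    obtain ⟨h0, h1⟩ := (D.χ_eq_one_iff g).mp h
    obtain ⟨⟨i, x, y⟩, rfl⟩ := (D.char_zero_eq_one_iff g).mp h0
    rw [D.char_one_e, ofAdd_eq_one, ZMod.intCast_zmod_eq_zero_iff_dvd] at h1
    obtain ⟨m, rfl⟩ := h1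
    exact D.exists_mk_eq m x y
  · rintro ⟨x, y, rfl⟩
    rw [D.χ_eq_one_iff]
    exact ⟨(D.char_zero_eq_one_iff _).mpr ⟨_, rfl⟩, by simp [D.char_one_e]⟩

theorem T2Data.card_ker_χ {n p q : ℕ} {z₁ z₂ : ℤ} {G : Type*} [Group G]
    (D : T2Data p q z₁ z₂ G) (P : T2Params n p q z₁ z₂) : Nat.card D.χ.ker = 3 ^ (n - 2) := by
  have hpq : p * q ≠ 0 := by
    rw [P.mul_eq]
    positivity
  have hp : p ≠ 0 := left_ne_zero_of_mul hpq
  have hq : q ≠ 0 := right_ne_zero_of_mul hpq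
  let f : Fin p × Fin q → D.χ.ker := fun u =>
    ⟨D.e (ofAdd (0, (u.1 : ℤ), (u.2 : ℤ))), (D.mem_ker_χ_iff _).mpr ⟨_, _, rfl⟩⟩
  have hf : Function.Bijective f := by
    constructor
    · rintro ⟨x, y⟩ ⟨x', y'⟩ h
      have h' := congrArg Subtype.val h
      simp only [f, D.e_eq_iff, Prod.mk_sub_mk, sub_zero, mem_relLattice_zero] at h'
      ext
      · exact (Nat.ModEq.eq_of_lt_of_lt
          ((Int.natCast_modEq_iff).mp ((Int.modEq_iff_dvd).mpr h'.1)) x'.2 x.2).symm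
      · exact (Nat.ModEq.eq_of_lt_of_lt
          ((Int.natCast_modEq_iff).mp ((Int.modEq_iff_dvd).mpr h'.2)) y'.2 y.2).symm
    · rintro ⟨g, hg⟩
      obtain ⟨x, y, rfl⟩ := (D.mem_ker_χ_iff _).mp hg
      have hx := Int.emod_nonneg x (b := p) (by exact_mod_cast hp)
      have hx' := Int.emod_lt_of_pos x (b := p) (by exact_mod_cast Nat.pos_of_ne_zero hp)
      have hy := Int.emod_nonneg y (b := q) (by exact_mod_cast hq)
      have hy' := Int.emod_lt_of_pos y (b := q) (by exact_mod_cast Nat.pos_of_ne_zero hq)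
      refine ⟨⟨⟨(x % p).toNat, by omega⟩, ⟨(y % q).toNat, by omega⟩⟩, Subtype.ext ?_⟩
      simp only [f, D.e_eq_iff, Prod.mk_sub_mk, sub_zero, mem_relLattice_zero]
      rw [Int.toNat_of_nonneg hx, Int.toNat_of_nonneg hy]
      exact ⟨(Int.mod_modEq x p).symm.dvd, (Int.mod_modEq y q).symm.dvd⟩
  rw [← Nat.card_eq_of_bijective f hf, Nat.card_prod, Nat.card_fin, Nat.card_fin, P.mul_eq]

theorem T2Data.card_eq {n p q : ℕ} {z₁ z₂ : ℤ} {G : Type*} [Group G]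
    (D : T2Data p q z₁ z₂ G) (P : T2Params n p q z₁ z₂) : Nat.card G = 9 * 3 ^ (n - 2) := by
  rw [← D.χ.ker.card_mul_index, Subgroup.index_ker, MonoidHom.range_eq_top.mpr D.χ_surjective,
    Subgroup.card_top, D.card_ker_χ P]
  simp
  ring

theorem T2Data.card_ker_char {n p q : ℕ} {z₁ z₂ : ℤ} {G : Type*} [Group G]
    (D : T2Data p q z₁ z₂ G) (P : T2Params n p q z₁ z₂) (j : Fin 2) :
    Nat.card (D.char j).ker = 3 * 3 ^ (n - 2) := by
  have h := (D.char j).ker.card_mul_index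
  rw [Subgroup.index_ker, MonoidHom.range_eq_top.mpr (D.char_surjective j),
    Subgroup.card_top, D.card_eq P, show Nat.card (Multiplicative (ZMod 3)) = 3 by simp] at h
  omega

theorem T2Data.finite {n p q : ℕ} {z₁ z₂ : ℤ} {G : Type*} [Group G]
    (D : T2Data p q z₁ z₂ G) (P : T2Params n p q z₁ z₂) : Finite G := by
  refine Nat.finite_of_card_ne_zero ?_
  rw [D.card_eq P]
  positivity

theorem T2Data.isPGroup {n p q : ℕ} {z₁ z₂ : ℤ} {G : Type*} [Group G]
    (D : T2Data p q z₁ z₂ G) (P : T2Params n p q z₁ z₂) : IsPGroup 3 G := by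
  refine IsPGroup.of_card (n := n - 2 + 2) ?_
  rw [D.card_eq P]
  ring

theorem T2Hom.commute_e {p q : ℕ} {z₁ z₂ : ℤ} {G : Type*} [Group G] (D : T2Hom p q z₁ z₂ G)
    (v w : ℤ × ℤ × ℤ) : Commute (D.e (ofAdd v)) (D.e (ofAdd w)) :=
  (Commute.all _ _).map D.e

/-- The element `z` of `T2(n)`. -/
def T2Hom.z {p q : ℕ} {z₁ z₂ : ℤ} {G : Type*} [Group G] (D : T2Hom p q z₁ z₂ G) : G :=
  D.e (ofAdd (0, z₁, z₂))

theorem T2Data.commute_a_iff {p q : ℕ} {z₁ z₂ : ℤ} {G : Type*} [Group G]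
    (D : T2Data p q z₁ z₂ G) (i x y : ℤ) : Commute (D.e (ofAdd (i, x, y))) D.a ↔
      (p : ℤ) ∣ 2 * i - 3 * x + 3 * y ∧ (q : ℤ) ∣ i - x := by
  rw [Commute.symm_iff, commute_iff_eq, ← mul_inv_eq_iff_eq_mul, D.conj, D.e_eq_iff, conjExp_mk,
    Prod.mk_sub_mk, Prod.mk_sub_mk, sub_self, mem_relLattice_zero]
  ring_nf

theorem T2Data.z_mem_center {n p q : ℕ} {z₁ z₂ : ℤ} {G : Type*} [Group G]
    (D : T2Data p q z₁ z₂ G) (P : T2Params n p q z₁ z₂) : D.z ∈ Subgroup.center G := by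
  have ha : Commute D.z D.a := by
    refine (D.commute_a_iff 0 z₁ z₂).mpr ⟨?_, ?_⟩
    · refine Int.dvd_of_eq_of_dvd ?_ P.p_dvd_z.neg_right
      ring
    · simpa using P.q_dvd_z
  rw [Subgroup.mem_center_iff]
  intro g
  obtain ⟨v, k, -, rfl⟩ := D.exists_eq g
  exact ((D.commute_e _ v).mul_right (ha.pow_right k)).symm.eq

theorem T2Data.z_pow_three {n p q : ℕ} {z₁ z₂ : ℤ} {G : Type*} [Group G]
    (D : T2Data p q z₁ z₂ G) (P : T2Params n p q z₁ z₂) : D.z ^ 3 = 1 := by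
  have hq : (q : ℤ) ∣ 3 * z₂ := by
    refine Int.dvd_of_eq_of_dvd ?_ ((P.q_dvd_z.mul_left 3).sub (P.q_dvd.trans P.p_dvd_z))
    ring
  rw [T2Hom.z, ← map_pow, ← ofAdd_nsmul, D.e_eq_one_iff]
  have : (3 • (0, z₁, z₂) : ℤ × ℤ × ℤ) = (0, 3 * z₁, 3 * z₂) := by simp
  rw [this, mem_relLattice_zero]
  exact ⟨P.p_dvd.trans (mul_dvd_mul_left 3 P.q_dvd_z), hq⟩

theorem T2Data.orderOf_z {n p q : ℕ} {z₁ z₂ : ℤ} {G : Type*} [Group G]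
    (D : T2Data p q z₁ z₂ G) (P : T2Params n p q z₁ z₂) : orderOf D.z = 3 := by
  have : Fact (Nat.Prime 3) := ⟨Nat.prime_three⟩
  refine orderOf_eq_prime (D.z_pow_three P) fun h => P.z_ne ?_
  rwa [T2Hom.z, D.e_eq_one_iff, mem_relLattice_zero] at h

theorem T2Data.mem_zpowers_z_of_commute_a {n p q : ℕ} {z₁ z₂ : ℤ} {G : Type*} [Group G]
    (D : T2Data p q z₁ z₂ G) (P : T2Params n p q z₁ z₂) {v : ℤ × ℤ × ℤ}
    (h : Commute (D.e (ofAdd v)) D.a) : D.e (ofAdd v) ∈ Subgroup.zpowers D.z := by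
  obtain ⟨i, x, y⟩ := v
  obtain ⟨m, rfl⟩ : (3 : ℤ) ∣ i := by
    have := (P.three_dvd.trans P.q_dvd).trans ((D.commute_a_iff i x y).mp h).1
    omega
  obtain ⟨x', y', hxy⟩ := D.exists_mk_eq m x y
  rw [hxy] at h ⊢
  obtain ⟨hp, hq⟩ := (D.commute_a_iff 0 x' y').mp h
  have hx : (q : ℤ) ∣ x' := by simpa using hq
  have hy : (p : ℤ) ∣ 3 * y' := by
    refine Int.dvd_of_eq_of_dvd ?_ (hp.add (P.p_dvd.trans (mul_dvd_mul_left 3 hx)))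
    ring
  obtain ⟨t, ht⟩ := P.exists_of_dvd x' y' hy (hx.sub (P.q_dvd.trans hy))
  refine ⟨t, ?_⟩
  have : (t • (0, z₁, z₂) : ℤ × ℤ × ℤ) = (0, t * z₁, t * z₂) := by simp
  simp only [T2Hom.z]
  rw [← map_zpow, ← ofAdd_zsmul, this, eq_comm, D.e_eq_iff, Prod.mk_sub_mk, Prod.mk_sub_mk,
    sub_self, mem_relLattice_zero]
  exact ht

theorem T2Data.mem_zpowers_z_of_commute {n p q : ℕ} {z₁ z₂ : ℤ} {G : Type*} [Group G]
    (D : T2Data p q z₁ z₂ G) (P : T2Params n p q z₁ z₂) {u g : G} (hu : D.char 0 u = 1)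
    (hg : D.char 0 g ≠ 1) (h : Commute u g) : u ∈ Subgroup.zpowers D.z := by
  obtain ⟨v, rfl⟩ := (D.char_zero_eq_one_iff u).mp hu
  obtain ⟨w, k, hk, rfl⟩ := D.exists_eq g
  refine D.mem_zpowers_z_of_commute_a P ?_
  have hak : Commute (D.e (ofAdd v)) (D.a ^ k) := by
    have := (D.commute_e v w).inv_right.mul_right h
    rwa [inv_mul_cancel_left] at this
  interval_cases k
  · exact absurd ((D.char_zero_mk _ 0).trans (by simp)) hg
  · simpa using hak
  · have : D.a = (D.a ^ 2) ^ 2 := by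
      rw [← pow_mul, pow_succ, D.a_pow, one_mul]
    rw [this]
    exact hak.pow_right 2

theorem T2Data.centralizer_of_mem_zpowers {n p q : ℕ} {z₁ z₂ : ℤ} {G : Type*} [Group G]
    (D : T2Data p q z₁ z₂ G) (P : T2Params n p q z₁ z₂) {g : G} (hg : g ∈ Subgroup.zpowers D.z) :
    Subgroup.centralizer {g} = ⊤ := by
  have hc : g ∈ Subgroup.center G :=
    (Subgroup.zpowers_le.mpr (D.z_mem_center P)) hg
  refine eq_top_iff.mpr fun h _ => ?_
  rw [Subgroup.mem_centralizer_singleton_iff]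
  exact Subgroup.mem_center_iff.mp hc h

theorem T2Data.centralizer_of_char_zero {n p q : ℕ} {z₁ z₂ : ℤ} {G : Type*} [Group G]
    (D : T2Data p q z₁ z₂ G) (P : T2Params n p q z₁ z₂) {g : G} (hg : D.char 0 g = 1)
    (hz : g ∉ Subgroup.zpowers D.z) : Subgroup.centralizer {g} = (D.char 0).ker := by
  ext h
  rw [Subgroup.mem_centralizer_singleton_iff, MonoidHom.mem_ker]
  constructor
  · intro hc
    by_contra hh
    exact hz (D.mem_zpowers_z_of_commute P hg hh (Commute.symm hc))
  · intro hh
    obtain ⟨v, rfl⟩ := (D.char_zero_eq_one_iff g).mp hg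
    obtain ⟨w, rfl⟩ := (D.char_zero_eq_one_iff h).mp hh
    exact D.commute_e w v

theorem T2Data.exists_of_mem_centralizer {n p q : ℕ} {z₁ z₂ : ℤ} {G : Type*} [Group G]
    (D : T2Data p q z₁ z₂ G) (P : T2Params n p q z₁ z₂) {g h : G} (hg : D.char 0 g ≠ 1)
    (hc : h ∈ Subgroup.centralizer {g}) : ∃ s j : ℤ, h = D.z ^ s * g ^ j := by
  have key : ∀ x y : ZMod 3, x ≠ 0 → ∃ j : Fin 3, y = j.val • x := by decide
  obtain ⟨j, hj⟩ := key (toAdd (D.char 0 g)) (toAdd (D.char 0 h)) hg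
  have hj' : D.char 0 h = D.char 0 g ^ j.val := hj
  rw [Subgroup.mem_centralizer_singleton_iff] at hc
  obtain ⟨s, hs⟩ := D.mem_zpowers_z_of_commute P (u := h * (g ^ j.val)⁻¹) (g := g)
    (by rw [map_mul, map_inv, map_pow, hj', mul_inv_cancel]) hg
    (Commute.mul_left hc ((Commute.refl g).pow_left _).inv_left)
  exact ⟨s, j.val, by simp only [hs, zpow_natCast, inv_mul_cancel_right]⟩

theorem T2Data.pow_three_of_char_zero_ne_one {p q : ℕ} {z₁ z₂ : ℤ} {G : Type*} [Group G]
    (D : T2Data p q z₁ z₂ G) {g : G} (hg : D.char 0 g ≠ 1) :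
    ∃ i : ℤ, g ^ 3 = D.z ^ i ∧ D.char 1 g = ofAdd (i : ZMod 3) := by
  obtain ⟨⟨i, x, y⟩, k, hk, rfl⟩ := D.exists_eq g
  refine ⟨i, ?_, D.char_one_mk _ _⟩
  have h3 : (D.e (ofAdd (i, x, y)) * D.a ^ k) ^ 3 = D.e (ofAdd ((i, x, y) +
      (conjExp^[k] (i, x, y) + conjExp^[k] (conjExp^[k] (i, x, y))))) * (D.a ^ 3) ^ k := by
    rw [ofAdd_add, ofAdd_add, map_mul, map_mul, ← pow_mul, mul_comm 3 k, pow_mul]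
    have h1 := D.a_mul k (i, x, y)
    have h2 := D.a_mul k (conjExp^[k] (i, x, y))
    generalize D.a ^ k = α at *
    generalize D.e (ofAdd (i, x, y)) = β at *
    generalize D.e (ofAdd (conjExp^[k] (i, x, y))) = γ at *
    calc _ = β * (α * β) * (α * β) * α := by simp only [pow_succ, pow_zero, one_mul, mul_assoc]
      _ = β * γ * (α * γ) * α * α := by rw [h1]; simp only [mul_assoc]
      _ = _ := by rw [h2]; simp only [pow_succ, pow_zero, one_mul, mul_assoc]
  rw [h3, D.a_pow, one_pow, mul_one, T2Hom.z, ← map_zpow, ← ofAdd_zsmul, D.e_eq_iff]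
  interval_cases k
  · exact absurd ((D.char_zero_mk _ 0).trans (by simp)) hg
  · simp only [Function.iterate_one, conjExp_mk, Prod.mk_add_mk, Prod.smul_mk, Prod.mk_sub_mk]
    refine ⟨i, ?_, ?_, ?_⟩ <;> simp <;> ring_nf <;> simp
  · simp only [Function.iterate_succ, Function.iterate_zero, Function.comp_apply, id, conjExp_mk,
      Prod.mk_add_mk, Prod.smul_mk, Prod.mk_sub_mk]
    refine ⟨i, ?_, ?_, ?_⟩ <;> simp <;> ring_nf <;> simp

theorem frattiniRank_of_centralizer_eq {G : Type*} [Group G] {g : G} {H : Subgroup G} {r : ℕ}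
    (h : Subgroup.centralizer {g} = H) (hr : Nat.card (H ⧸ frattini H) = 3 ^ r) :
    frattiniRank g = r := by
  subst h
  rw [frattiniRank, hr, Nat.log_pow (by norm_num)]

theorem card_quotient_frattini_of_zpowers_eq_top {H : Type*} [Group H] [Finite H]
    (hH : IsPGroup 3 H) {x : H} (hx : Subgroup.zpowers x = ⊤) (ho : 3 ∣ orderOf x) :
    Nat.card (H ⧸ frattini H) = 3 := by
  have hr : ∀ j : ℤ, (j : ZMod 3) = 0 ↔ 3 ∣ j := fun j => ZMod.intCast_zmod_eq_zero_iff_dvd j 3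
  let g : Multiplicative ℤ →* Multiplicative (Fin 1 → ZMod 3) := AddMonoidHom.toMultiplicative
    (AddMonoidHom.pi fun _ => Int.castAddHom (ZMod 3))
  have hg : ∀ j : ℤ, g (ofAdd j) = 1 ↔ (3 : ℤ) ∣ j := by
    intro j
    rw [← hr]
    exact ⟨fun h => congrFun (congrArg toAdd h) 0, fun h => toAdd.injective (funext fun _ => h)⟩
  refine (card_quotient_frattini (r := 1) (e := zpowersHom H x) (g := g) ?_ ?_ ?_ ?_).trans
    (pow_one 3)
  · intro y
    have hy : y ∈ Subgroup.zpowers x := hx ▸ Subgroup.mem_top y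
    obtain ⟨j, rfl⟩ := hy
    exact ⟨ofAdd j, rfl⟩
  · intro f
    refine ⟨ofAdd ((toAdd f 0).val : ℤ), toAdd.injective (funext fun i => ?_)⟩
    fin_cases i
    exact (Int.cast_natCast _).trans (ZMod.natCast_zmod_val _)
  · intro j hj
    refine (hg (toAdd j)).mpr ((Int.natCast_dvd_natCast.mpr ho).trans ?_)
    exact orderOf_dvd_iff_zpow_eq_one.mpr hj
  · intro j hj
    obtain ⟨t, ht⟩ := (hg (toAdd j)).mp hj
    have : zpowersHom H x j = (x ^ t) ^ 3 := by
      rw [zpowersHom_apply, ht, mul_comm, zpow_mul]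
      norm_cast
    rw [this]
    exact pow_three_mem_frattini hH _

theorem T2Data.frattiniRank_of_mem_zpowers {n p q : ℕ} {z₁ z₂ : ℤ} {G : Type*} [Group G]
    (D : T2Data p q z₁ z₂ G) (P : T2Params n p q z₁ z₂) {g : G} (hg : g ∈ Subgroup.zpowers D.z) :
    frattiniRank g = 2 := by
  have := D.finite P
  refine frattiniRank_of_centralizer_eq (D.centralizer_of_mem_zpowers P hg) ?_
  rw [card_quotient_frattini_congr Subgroup.topEquiv]
  refine card_quotient_frattini (e := MonoidHom.id G) (g := D.χ) Function.surjective_id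
    D.χ_surjective ?_ ?_
  · rintro _ rfl
    exact one_mem _
  · intro h hh
    obtain ⟨x, y, rfl⟩ := (D.mem_ker_χ_iff h).mp hh
    have h1 := D.conj (3 * y - x, 2 * y - x, 0)
    have h2 : conjExp (3 * y - x, 2 * y - x, 0) = (0, x, y) + (3 * y - x, 2 * y - x, 0) := by
      rw [conjExp_mk]
      ext <;> simp <;> ring
    rw [h2, ofAdd_add, map_mul, ← mul_inv_eq_iff_eq_mul] at h1
    have h3 := inv_mul_inv_mul_mul_mem_frattini (D.isPGroup P) D.a⁻¹
      (D.e (ofAdd (3 * y - x, 2 * y - x, 0)))⁻¹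
    rw [inv_inv, inv_inv, h1] at h3
    exact h3

theorem T2Data.card_centralizer_of_elementary {n p q : ℕ} {z₁ z₂ : ℤ} {G : Type*} [Group G]
    (D : T2Data p q z₁ z₂ G) (P : T2Params n p q z₁ z₂) {g : G} (h0 : D.char 0 g ≠ 1)
    (h1 : D.char 1 g = 1) :
    frattiniRank g = 2 ∧ Nat.card (Subgroup.centralizer {g}) = 9 := by
  have hr : ∀ j : ℤ, (j : ZMod 3) = 0 ↔ 3 ∣ j := fun j => ZMod.intCast_zmod_eq_zero_iff_dvd j 3
  have hg3 : g ^ 3 = 1 := by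
    obtain ⟨i, hi, hi'⟩ := D.pow_three_of_char_zero_ne_one h0
    rw [h1, eq_comm, ofAdd_eq_one, hr] at hi'
    rw [hi, ← orderOf_dvd_iff_zpow_eq_one, D.orderOf_z P]
    exact hi'
  have hz : ∀ u, Commute D.z u := fun u => (Subgroup.mem_center_iff.mp (D.z_mem_center P) u).symm
  let e : Multiplicative (ℤ × ℤ) →* Subgroup.centralizer {g} := MonoidHom.mk'
    (fun v => ⟨D.z ^ (toAdd v).1 * g ^ (toAdd v).2, by
      rw [Subgroup.mem_centralizer_singleton_iff]
      exact ((hz g).zpow_left _).mul_left ((Commute.refl g).zpow_left _)⟩) (by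
      intro v w
      refine Subtype.ext ?_
      simp only [toAdd_mul, Prod.fst_add, Prod.snd_add, zpow_add, Subgroup.coe_mul]
      exact ((hz _).zpow_left _).mul_mul_mul_comm _ _)
  have he : ∀ v, (e v : G) = D.z ^ (toAdd v).1 * g ^ (toAdd v).2 := fun v => rfl
  have hes : Function.Surjective e := by
    rintro ⟨h, hh⟩
    obtain ⟨s, j, hsj⟩ := D.exists_of_mem_centralizer P h0 hh
    exact ⟨ofAdd (s, j), Subtype.ext hsj.symm⟩
  let f : Multiplicative (ℤ × ℤ) →* Multiplicative (Fin 2 → ZMod 3) :=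
    AddMonoidHom.toMultiplicative
      { toFun := fun v => ![(v.1 : ZMod 3), (v.2 : ZMod 3)]
        map_zero' := by simp
        map_add' := by simp }
  have hf : ∀ v, f v = 1 ↔ (3 : ℤ) ∣ (toAdd v).1 ∧ (3 : ℤ) ∣ (toAdd v).2 := by
    intro v
    rw [← hr, ← hr]
    refine ⟨fun h => ⟨congrFun (congrArg toAdd h) 0, congrFun (congrArg toAdd h) 1⟩, fun h => ?_⟩
    refine toAdd.injective (funext fun j => ?_)
    fin_cases j
    · exact h.1
    · exact h.2
  have hfs : Function.Surjective f := by
    intro w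
    refine ⟨ofAdd (((toAdd w 0).val : ℤ), ((toAdd w 1).val : ℤ)),
      toAdd.injective (funext fun j => ?_)⟩
    fin_cases j <;> simp [f]
  have hone : ∀ v, f v = 1 → e v = 1 := by
    intro v hv
    obtain ⟨⟨s, hs⟩, ⟨t, ht⟩⟩ := (hf v).mp hv
    refine Subtype.ext ?_
    rw [he, hs, ht, zpow_mul, zpow_mul]
    have hz3 := D.z_pow_three P
    norm_cast
    simp [hz3, hg3]
  have hker : e.ker = f.ker := by
    refine le_antisymm (fun v hv => ?_) (fun v hv => hone v hv)
    have hv' : D.z ^ (toAdd v).1 * g ^ (toAdd v).2 = 1 := congrArg Subtype.val hv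
    have hzc : D.char 0 D.z = 1 := (D.char_zero_eq_one_iff _).mpr ⟨_, rfl⟩
    have h2 : (3 : ℤ) ∣ (toAdd v).2 := by
      have := congrArg (D.char 0) hv'
      rw [map_mul, map_zpow, map_zpow, hzc, one_zpow, one_mul, map_one,
        ← orderOf_dvd_iff_zpow_eq_one, orderOf_eq_prime (p := 3) ?_ h0] at this
      · exact this
      · rw [← map_pow, hg3, map_one]
    obtain ⟨t, ht⟩ := h2
    have h3 : D.z ^ (toAdd v).1 = 1 := by
      rw [ht, zpow_mul] at hv'
      norm_cast at hv'
      simpa [hg3] using hv'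
    rw [← orderOf_dvd_iff_zpow_eq_one, D.orderOf_z P] at h3
    exact (hf v).mpr ⟨h3, ⟨t, ht⟩⟩
  constructor
  · refine frattiniRank_of_centralizer_eq rfl
      (card_quotient_frattini hes hfs hker.le fun v hv => ?_)
    rw [hone v hv]
    exact one_mem _
  · have hc := Subgroup.index_ker e
    rw [hker, Subgroup.index_ker, MonoidHom.range_eq_top.mpr hfs, MonoidHom.range_eq_top.mpr hes,
      Subgroup.card_top, Subgroup.card_top] at hc
    rw [← hc]
    simp

theorem T2Data.card_centralizer_of_cyclic {n p q : ℕ} {z₁ z₂ : ℤ} {G : Type*} [Group G]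
    (D : T2Data p q z₁ z₂ G) (P : T2Params n p q z₁ z₂) {g : G} (h0 : D.char 0 g ≠ 1)
    (h1 : D.char 1 g ≠ 1) :
    frattiniRank g = 1 ∧ Nat.card (Subgroup.centralizer {g}) = 9 := by
  have := D.finite P
  have : Fact (Nat.Prime 3) := ⟨Nat.prime_three⟩
  obtain ⟨i, hi, hi'⟩ := D.pow_three_of_char_zero_ne_one h0
  have hi3 : ¬ (3 : ℤ) ∣ i := by
    intro h
    rw [← Nat.cast_ofNat, ← ZMod.intCast_zmod_eq_zero_iff_dvd] at h
    exact h1 (by rw [hi', h, ofAdd_zero])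
  have hz3 : D.z ^ (3 : ℤ) = 1 := by
    exact_mod_cast D.z_pow_three P
  have ho : orderOf g = 3 ^ (1 + 1) := by
    refine orderOf_eq_prime_pow ?_ ?_
    · rw [pow_one, hi, ← orderOf_dvd_iff_zpow_eq_one, D.orderOf_z P]
      exact hi3
    · rw [pow_succ, pow_one, pow_mul, hi, ← zpow_natCast, ← zpow_mul, mul_comm, zpow_mul]
      norm_num [hz3]
  have hzg : D.z = g ^ (3 * i) := by
    obtain ⟨m, hm⟩ : (3 : ℤ) ∣ i * i - 1 := by
      obtain ⟨m, rfl | rfl | rfl⟩ : ∃ m, i = 3 * m ∨ i = 3 * m + 1 ∨ i = 3 * m + 2 :=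
        ⟨i / 3, by omega⟩
      · exact absurd ⟨m, rfl⟩ hi3
      · exact ⟨3 * m ^ 2 + 2 * m, by ring⟩
      · exact ⟨3 * m ^ 2 + 4 * m + 1, by ring⟩
    have hg3 : g ^ (3 : ℤ) = D.z ^ i := by
      exact_mod_cast hi
    rw [zpow_mul, hg3, ← zpow_mul, show i * i = 3 * m + 1 by omega, zpow_add, zpow_mul, hz3,
      one_zpow, one_mul, zpow_one]
  have hC : Subgroup.centralizer {g} = Subgroup.zpowers g := by
    refine le_antisymm (fun h hh => ?_) ?_
    · obtain ⟨s, j, rfl⟩ := D.exists_of_mem_centralizer P h0 hh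
      rw [hzg]
      exact mul_mem (zpow_mem (zpow_mem (Subgroup.mem_zpowers g) _) _)
        (zpow_mem (Subgroup.mem_zpowers g) _)
    · rw [Subgroup.zpowers_le, Subgroup.mem_centralizer_singleton_iff]
  constructor
  · refine frattiniRank_of_centralizer_eq hC ?_
    refine (card_quotient_frattini_of_zpowers_eq_top ((D.isPGroup P).to_subgroup _)
      (x := ⟨g, Subgroup.mem_zpowers g⟩) ?_ ?_).trans (pow_one 3).symm
    · refine eq_top_iff.mpr ?_
      rintro ⟨_, j, rfl⟩ -
      exact ⟨j, rfl⟩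
    · rw [Subgroup.orderOf_mk, ho]
      norm_num
  · rw [hC, Nat.card_zpowers, ho]
    norm_num

theorem T2Data.SInvariant_add {n p q : ℕ} {z₁ z₂ : ℤ} {G : Type*} [Group G]
    (D : T2Data p q z₁ z₂ G) (P : T2Params n p q z₁ z₂) {r : ℕ}
    (hr : Nat.card ((D.char 0).ker ⧸ frattini (D.char 0).ker) = 3 ^ r) :
    SInvariant G + r = 14 + r * 3 ^ (n - 2) := by
  classical
  have := D.finite P
  have : Fintype G := Fintype.ofFinite G
  set M := 3 ^ (n - 2) with hM
  have hMpos : 0 < M := by positivity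
  have hind : ∀ (H : Subgroup G) [DecidablePred (· ∈ H)] (m : ℕ),
      ∑ g : G, (if g ∈ H then m else 0) = Nat.card H * m := by
    intro H _ m
    rw [← Finset.sum_filter, Finset.sum_const, smul_eq_mul, Nat.card_eq_fintype_card,
      Fintype.card_subtype]
  have hpt : ∀ g : G, frattiniRank g * Nat.card (Subgroup.centralizer {g}) +
      ((if g ∈ D.χ.ker then 9 else 0) + (if g ∈ (D.char 0).ker then 9 else 0) +
        (if g ∈ Subgroup.zpowers D.z then r * (3 * M) else 0)) =
      9 + (if g ∈ (D.char 0).ker then r * (3 * M) else 0) +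
        (if g ∈ Subgroup.zpowers D.z then 18 * M else 0) +
        (if g ∈ (D.char 1).ker then 9 else 0) := by
    intro g
    have hχ := D.χ_eq_one_iff g
    by_cases hz : g ∈ Subgroup.zpowers D.z
    · have h1 : D.χ g = 1 := by
        have : Subgroup.zpowers D.z ≤ D.χ.ker := by
          rw [Subgroup.zpowers_le, D.mem_ker_χ_iff]
          exact ⟨_, _, rfl⟩
        exact this hz
      have h2 := hχ.mp h1
      simp only [MonoidHom.mem_ker, h1, h2, hz, if_true, D.frattiniRank_of_mem_zpowers P hz,
        D.centralizer_of_mem_zpowers P hz, Subgroup.card_top, D.card_eq P]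
      omega
    · by_cases h0 : D.char 0 g = 1
      · have hc := D.centralizer_of_char_zero P h0 hz
        rw [frattiniRank_of_centralizer_eq hc hr, hc, D.card_ker_char P, ← hM]
        simp only [MonoidHom.mem_ker, hχ, h0, hz, if_true, if_false, true_and]
        omega
      · by_cases h1 : D.char 1 g = 1
        · simp only [MonoidHom.mem_ker, hχ, h0, hz, h1, if_true, if_false, false_and,
            D.card_centralizer_of_elementary P h0 h1]
        · simp only [MonoidHom.mem_ker, hχ, h0, hz, h1, if_false, false_and,
            D.card_centralizer_of_cyclic P h0 h1]
  have hsum := Finset.sum_congr rfl fun g (_ : g ∈ Finset.univ) => hpt g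
  simp only [Finset.sum_add_distrib, hind, D.card_ker_χ P, D.card_ker_char P, Nat.card_zpowers,
    D.orderOf_z P, ← card_mul_SInvariant, D.card_eq P, Finset.sum_const, Finset.card_univ,
    ← Nat.card_eq_fintype_card (α := G), smul_eq_mul, ← hM] at hsum
  refine Nat.eq_of_mul_eq_mul_left (show 0 < 9 * M by omega) ?_
  linarith

theorem T2Data.card_quotient_frattini_ker_char {n p q : ℕ} {z₁ z₂ : ℤ} {G : Type*} [Group G]
    (D : T2Data p q z₁ z₂ G) (P : T2Params n p q z₁ z₂) {r : ℕ}
    {f : Multiplicative (ℤ × ℤ × ℤ) →* Multiplicative (Fin r → ZMod 3)}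
    (hf : Function.Surjective f) (hrel : ∀ v ∈ relLattice p q z₁ z₂, f (ofAdd v) = 1)
    (hcube : ∀ v, f (ofAdd v) = 1 → ∃ w, v - (3 : ℤ) • w ∈ relLattice p q z₁ z₂) :
    Nat.card ((D.char 0).ker ⧸ frattini (D.char 0).ker) = 3 ^ r := by
  have := D.finite P
  let e : Multiplicative (ℤ × ℤ × ℤ) →* (D.char 0).ker :=
    D.e.codRestrict _ fun v => (D.char_zero_eq_one_iff _).mpr ⟨toAdd v, rfl⟩
  refine card_quotient_frattini (e := e) (g := f) ?_ hf ?_ ?_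
  · rintro ⟨g, hg⟩
    obtain ⟨v, rfl⟩ := (D.char_zero_eq_one_iff g).mp hg
    exact ⟨ofAdd v, rfl⟩
  · intro v hv
    exact hrel (toAdd v) (D.mem_of_e_eq_one _ (congrArg Subtype.val hv))
  · intro v hv
    obtain ⟨w, hw⟩ := hcube (toAdd v) hv
    have : e v = e (ofAdd w) ^ 3 := by
      rw [← map_pow]
      refine Subtype.ext ((D.e_eq_iff (toAdd v) ((3 : ℕ) • w)).mpr ?_)
      exact_mod_cast hw
    rw [this]
    exact pow_three_mem_frattini ((D.isPGroup P).to_subgroup _) _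

theorem T2Data.card_quotient_frattini_ker_char_of_dvd {n p q : ℕ} {z₁ z₂ : ℤ} {G : Type*}
    [Group G] (D : T2Data p q z₁ z₂ G) (P : T2Params n p q z₁ z₂) (h₁ : (3 : ℤ) ∣ z₁)
    (h₂ : (3 : ℤ) ∣ z₂) :
    Nat.card ((D.char 0).ker ⧸ frattini (D.char 0).ker) = 3 ^ 2 := by
  have hr : ∀ j : ℤ, (j : ZMod 3) = 0 ↔ 3 ∣ j := fun j => ZMod.intCast_zmod_eq_zero_iff_dvd j 3
  let f : Multiplicative (ℤ × ℤ × ℤ) →* Multiplicative (Fin 2 → ZMod 3) :=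
    AddMonoidHom.toMultiplicative
      { toFun := fun v => ![(v.1 : ZMod 3), (v.2.1 : ZMod 3)]
        map_zero' := by simp
        map_add' := by simp }
  have hf : ∀ i x y : ℤ, f (ofAdd (i, x, y)) = 1 ↔ (3 : ℤ) ∣ i ∧ (3 : ℤ) ∣ x := by
    intro i x y
    rw [← hr, ← hr]
    refine ⟨fun h => ⟨congrFun (congrArg toAdd h) 0, congrFun (congrArg toAdd h) 1⟩, fun h => ?_⟩
    refine toAdd.injective (funext fun j => ?_)
    fin_cases j
    · exact h.1
    · exact h.2
  refine D.card_quotient_frattini_ker_char P (f := f) ?_ ?_ ?_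
  · intro w
    refine ⟨ofAdd (((toAdd w 0).val : ℤ), ((toAdd w 1).val : ℤ), 0),
      toAdd.injective (funext fun j => ?_)⟩
    fin_cases j <;> simp [f]
  · rintro ⟨i, x, y⟩ ⟨k, hi, hx, -⟩
    refine (hf i x y).mpr ⟨⟨k, hi⟩, ?_⟩
    refine Int.dvd_of_eq_of_dvd ?_ (((P.three_dvd.trans P.q_dvd).trans hx).add
      (((dvd_refl 3).sub h₁).mul_left k))
    ring
  · rintro ⟨i, x, y⟩ hv
    obtain ⟨⟨k, rfl⟩, ⟨m, rfl⟩⟩ := (hf i x y).mp hv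
    obtain ⟨s, rfl⟩ := h₁
    obtain ⟨t, rfl⟩ := h₂
    refine ⟨(k - y, m - y * (1 - s), y * t), y, ?_, ?_, ?_⟩ <;> simp <;> ring_nf <;> simp

theorem T2Data.card_quotient_frattini_ker_char_three {z₁ z₂ : ℤ} {G : Type*}
    [Group G] (D : T2Data 3 3 z₁ z₂ G) (P : T2Params 4 3 3 z₁ z₂) (h₁ : (3 : ℤ) ∣ z₁)
    (h₂ : (3 : ℤ) ∣ 1 - z₂) :
    Nat.card ((D.char 0).ker ⧸ frattini (D.char 0).ker) = 3 ^ 3 := by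
  have hr : ∀ j : ℤ, (j : ZMod 3) = 0 ↔ 3 ∣ j := fun j => ZMod.intCast_zmod_eq_zero_iff_dvd j 3
  let f : Multiplicative (ℤ × ℤ × ℤ) →* Multiplicative (Fin 3 → ZMod 3) :=
    AddMonoidHom.toMultiplicative
      { toFun := fun v => ![(v.1 : ZMod 3), (v.2.1 : ZMod 3), (v.2.2 : ZMod 3)]
        map_zero' := by simp
        map_add' := by simp }
  have hf : ∀ i x y : ℤ, f (ofAdd (i, x, y)) = 1 ↔
      (3 : ℤ) ∣ i ∧ (3 : ℤ) ∣ x ∧ (3 : ℤ) ∣ y := by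
    intro i x y
    rw [← hr, ← hr, ← hr]
    refine ⟨fun h => ⟨congrFun (congrArg toAdd h) 0, congrFun (congrArg toAdd h) 1,
      congrFun (congrArg toAdd h) 2⟩, fun h => ?_⟩
    refine toAdd.injective (funext fun j => ?_)
    fin_cases j
    · exact h.1
    · exact h.2.1
    · exact h.2.2
  refine D.card_quotient_frattini_ker_char P (f := f) ?_ ?_ ?_
  · intro w
    refine ⟨ofAdd (((toAdd w 0).val : ℤ), ((toAdd w 1).val : ℤ), ((toAdd w 2).val : ℤ)),
      toAdd.injective (funext fun j => ?_)⟩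
    fin_cases j <;> simp [f]
  · rintro ⟨i, x, y⟩ ⟨k, hi, hx, hy⟩
    refine (hf i x y).mpr ⟨⟨k, hi⟩, ?_, ?_⟩
    · refine Int.dvd_of_eq_of_dvd ?_ (hx.add (((dvd_refl 3).sub h₁).mul_left k))
      simp
    · refine Int.dvd_of_eq_of_dvd ?_ (hy.add (h₂.mul_left k))
      simp
  · rintro ⟨i, x, y⟩ hv
    obtain ⟨⟨k, rfl⟩, ⟨l, rfl⟩, ⟨m, rfl⟩⟩ := (hf i x y).mp hv
    exact ⟨(k, l, m), by simp⟩

theorem T2Params.even {k : ℕ} (hk : 1 ≤ k) {z₂ : ℤ} (hz : z₂ = (-3) ^ (k - 1)) :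
    T2Params (2 * k + 2) (3 ^ k) (3 ^ k) 0 z₂ := by
  obtain ⟨k, rfl⟩ : ∃ j, k = j + 1 := ⟨k - 1, by omega⟩
  have hz3 : z₂ = (-1) ^ k * 3 ^ k := by
    rw [hz, ← mul_pow]
    norm_num
  have hu : ((-1 : ℤ) ^ k) * (-1) ^ k = 1 := by
    rw [← mul_pow]
    norm_num
  refine ⟨?_, ?_, dvd_rfl, ⟨3, by ring⟩, dvd_zero _, ?_, ?_, ?_⟩
  · rw [← pow_add]
    congr 1
    omega
  · push_cast
    exact ⟨3 ^ k, by ring⟩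
  · exact ⟨-(-1) ^ k, by push_cast; rw [hz3]; ring⟩
  · intro x y hy hx
    obtain ⟨t, ht⟩ : (3 : ℤ) ^ k ∣ y := by
      have : (3 : ℤ) * 3 ^ k ∣ 3 * y := by
        convert hy using 1
        push_cast
        ring
      exact Int.dvd_of_mul_dvd_mul_left (by norm_num) this
    refine ⟨t * (-1) ^ k, ?_, ?_⟩
    · refine Int.dvd_of_eq_of_dvd ?_ (hx.add hy)
      ring
    · have : y - t * (-1) ^ k * z₂ = 0 := by
        rw [ht, hz3]
        linear_combination (-(t * 3 ^ k)) * hu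
      rw [this]
      exact dvd_zero _
  · rintro ⟨-, h⟩
    rw [hz3] at h
    push_cast at h
    have := h.mul_left ((-1 : ℤ) ^ k)
    rw [← mul_assoc, hu, one_mul] at this
    have h' : (3 : ℤ) ^ (k + 1) ≤ 3 ^ k := Int.le_of_dvd (by positivity) this
    have : (0 : ℤ) < 3 ^ k := by positivity
    rw [pow_succ] at h'
    omega

theorem T2Params.odd {k : ℕ} (hk : 1 ≤ k) {z₁ : ℤ} (hz : z₁ = (-3) ^ k) :
    T2Params (2 * k + 3) (3 ^ (k + 1)) (3 ^ k) z₁ 0 := by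
  have hz3 : z₁ = (-1) ^ k * 3 ^ k := by
    rw [hz, ← mul_pow]
    norm_num
  have hu : ((-1 : ℤ) ^ k) * (-1) ^ k = 1 := by
    rw [← mul_pow]
    norm_num
  refine ⟨?_, ?_, ?_, ?_, ?_, ?_, ?_, ?_⟩
  · rw [← pow_add]
    congr 1
    omega
  · push_cast
    exact dvd_pow_self 3 (by omega)
  · exact ⟨3, by push_cast; ring⟩
  · exact ⟨1, by push_cast; ring⟩
  · exact ⟨(-1) ^ k, by push_cast; rw [hz3]; ring⟩
  · exact ⟨(-1) ^ k, by push_cast; rw [hz3]; ring⟩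
  · intro x y hy hx
    have hy' : (3 : ℤ) ^ k ∣ y := by
      have : (3 : ℤ) * 3 ^ k ∣ 3 * y := by
        convert hy using 1
        push_cast
        ring
      exact Int.dvd_of_mul_dvd_mul_left (by norm_num) this
    push_cast at hx hy ⊢
    obtain ⟨t, ht⟩ : (3 : ℤ) ^ k ∣ x := by
      refine Int.dvd_of_eq_of_dvd ?_ (hx.add (hy'.mul_left 3))
      ring
    refine ⟨t * (-1) ^ k, ?_, by simpa using hy'⟩
    have : x - t * (-1) ^ k * z₁ = 0 := by
      rw [ht, hz3]
      linear_combination (-(t * 3 ^ k)) * hu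
    rw [this]
    exact dvd_zero _
  · rintro ⟨h, -⟩
    rw [hz3] at h
    push_cast at h
    have := h.mul_left ((-1 : ℤ) ^ k)
    rw [← mul_assoc, hu, one_mul] at this
    have h' : (3 : ℤ) ^ (k + 1) ≤ 3 ^ k := Int.le_of_dvd (by positivity) this
    have : (0 : ℤ) < 3 ^ k := by positivity
    rw [pow_succ] at h'
    omega

theorem T2Words.even (k : ℕ) {z₂ : ℤ} (hz : z₂ = (-3) ^ (k - 1)) :
    T2Words (2 * k + 2) (3 ^ k) (3 ^ k) 0 z₂ := by
  have he : Even (2 * k + 2) := ⟨k + 1, by ring⟩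
  have h1 : (2 * k + 2 - 2) / 2 = k := by omega
  have h2 : (2 * k + 2 - 4) / 2 = k - 1 := by omega
  refine ⟨?_, ?_⟩
  · rw [if_pos he, h1]
  · rw [MaxClass3.zWord, if_pos he, h2, zpow_zero, one_mul, hz]

theorem T2Words.odd (k : ℕ) {z₁ : ℤ} (hz : z₁ = (-3) ^ k) :
    T2Words (2 * k + 3) (3 ^ (k + 1)) (3 ^ k) z₁ 0 := by
  have he : ¬ Even (2 * k + 3) := Nat.not_even_iff_odd.mpr ⟨k + 1, by ring⟩
  have h1 : (2 * k + 3 - 1) / 2 = k + 1 := by omega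
  have h2 : (2 * k + 3 - 3) / 2 = k := by omega
  refine ⟨?_, ?_⟩
  · rw [if_neg he, h1, h2]
  · rw [MaxClass3.zWord, if_neg he, h2, zpow_zero, mul_one, hz]

end

open MaxClass3 in
/-- For `n ≥ 5`, the group `T2(n)` satisfies `S(T2(n)) = 12 + 2·3^{n-2}`, while
`S(T2(4)) = 38`. -/
theorem SInvariant_T2 :
    (∀ n : ℕ, 5 ≤ n → SInvariant (T2 n) = 12 + 2 * 3 ^ (n - 2)) ∧
      SInvariant (T2 4) = 38 := by
  constructor
  · intro n hn
    have of_params : ∀ {p q : ℕ} {z₁ z₂ : ℤ}, T2Params n p q z₁ z₂ → T2Words n p q z₁ z₂ →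
        (3 : ℤ) ∣ z₁ → (3 : ℤ) ∣ z₂ → SInvariant (T2 n) = 12 + 2 * 3 ^ (n - 2) := by
      intro p q z₁ z₂ P W h₁ h₂
      obtain ⟨D⟩ := T2Data.nonempty P W
      have := D.SInvariant_add P (D.card_quotient_frattini_ker_char_of_dvd P h₁ h₂)
      omega
    have h3 : ∀ j : ℕ, 1 ≤ j → (3 : ℤ) ∣ (-3) ^ j := fun j hj =>
      dvd_pow (by norm_num) (by omega)
    rcases Nat.even_or_odd' n with ⟨m, rfl | rfl⟩
    · obtain ⟨k, rfl⟩ : ∃ k, m = k + 1 := ⟨m - 1, by omega⟩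
      exact of_params (T2Params.even (by omega) rfl) (T2Words.even k rfl) (dvd_zero 3)
        (h3 _ (by omega))
    · obtain ⟨k, rfl⟩ : ∃ k, m = k + 1 := ⟨m - 1, by omega⟩
      exact of_params (T2Params.odd (by omega) rfl) (T2Words.odd k rfl) (h3 _ (by omega))
        (dvd_zero 3)
  · have P : T2Params 4 3 3 0 1 := T2Params.even le_rfl rfl
    obtain ⟨D⟩ := T2Data.nonempty P (T2Words.even 1 rfl)
    have := D.SInvariant_add P (D.card_quotient_frattini_ker_char_three P (dvd_zero 3) (by simp))
    omega
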